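/- arXiv:2206.15424 — 3 statements merged into one kernel-verified Lean document; each statement's English description precedes it below -/
import Mathlib

section
/- Let G be a connected graph, X a cluster modulator of G, and C1, C2 two distinct identical cliques of G − X. Let u ∈ C1 and v ∈ C2 be clones. Then for every vertex w ∈ V(G) \ (V(C1) ∪ V(C2)), d(u, w) = d(v, w). -/
open SimpleGraph

variable {V : Type*}

/-- Two distinct vertices are true twins if they have equal closed neighborhoods. -/
def TrueTwins (G : SimpleGraph V) (u v : V) : Prop :=
  u ≠ v ∧ insert u (G.neighborSet u) = insert v (G.neighborSet v)

/-- Two distinct vertices are false twins if they have equal open neighborhoods. -/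
def FalseTwins (G : SimpleGraph V) (u v : V) : Prop :=
  u ≠ v ∧ G.neighborSet u = G.neighborSet v

/-- A set `S` is a resolving set of `G`. -/
def IsResolving {W : Type*} (G : SimpleGraph W) (S : Set W) : Prop :=
  ∀ u v : W, u ≠ v → ∃ w ∈ S, G.dist w u ≠ G.dist w v

/-- A graph is a cluster graph: every connected component is a clique. -/
def IsClusterGraph {W : Type*} (H : SimpleGraph W) : Prop :=
  ∀ a b : W, H.Reachable a b → a = b ∨ H.Adj a b

/-- `X` is a cluster modulator of `G`: `G - X` is a cluster graph. -/
def IsClusterModulator (G : SimpleGraph V) (X : Set V) : Prop :=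
  IsClusterGraph (G.induce Xᶜ)

/-- `C` is a clique of `G - X`, i.e. a connected component of `G - X`
(which is a clique when `X` is a cluster modulator). -/
def IsCliqueComponent (G : SimpleGraph V) (X C : Set V) : Prop :=
  C.Nonempty ∧ C ⊆ Xᶜ ∧ (∀ a ∈ C, ∀ b ∈ C, a ≠ b → G.Adj a b) ∧
    (∀ a ∈ C, ∀ b : V, b ∉ X → G.Adj a b → b ∈ C)

/-- Two vertices are clones (w.r.t. the modulator `X`) if they have the same
neighborhood in `X`. -/
def Clones (G : SimpleGraph V) (X : Set V) (u v : V) : Prop :=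
  G.neighborSet u ∩ X = G.neighborSet v ∩ X

/-- Two cliques of `G - X` are identical if their signatures (multisets of
neighborhoods in `X`) coincide, i.e. there is a bijection matching vertices
with equal neighborhoods in `X`. -/
def Identical (G : SimpleGraph V) (X C1 C2 : Set V) : Prop :=
  ∃ f : ↥C1 ≃ ↥C2, ∀ u : ↥C1, G.neighborSet (↑(f u)) ∩ X = G.neighborSet (↑u) ∩ X

/-- `𝒞` is an equivalence class of identical cliques of `G - X`:
a maximal set of pairwise identical cliques of `G - X`. -/
def IsIdenticalClass (G : SimpleGraph V) (X : Set V) (𝒞 : Set (Set V)) : Prop :=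
  (∀ C ∈ 𝒞, IsCliqueComponent G X C) ∧
  (∀ C1 ∈ 𝒞, ∀ C2 ∈ 𝒞, Identical G X C1 C2) ∧
  (∀ C, IsCliqueComponent G X C → (∃ C' ∈ 𝒞, Identical G X C C') → C ∈ 𝒞)

/-- The number of unordered pairs of true twins of `G` contained in `C`. -/
noncomputable def twinPairCount (G : SimpleGraph V) (C : Set V) : ℕ :=
  {p : Set V | ∃ u ∈ C, ∃ v ∈ C, TrueTwins G u v ∧ p = {u, v}}.ncard

/-- No three distinct vertices of `G` are pairwise true twins. -/
def NoThreeTrueTwins (G : SimpleGraph V) : Prop :=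
  ¬ ∃ u v w : V, TrueTwins G u v ∧ TrueTwins G u w ∧ TrueTwins G v w

/-- No three distinct vertices of `G` are pairwise false twins. -/
def NoThreeFalseTwins (G : SimpleGraph V) : Prop :=
  ¬ ∃ u v w : V, FalseTwins G u v ∧ FalseTwins G u w ∧ FalseTwins G v w

/-- `I` is an independent set of `G - X` corresponding to a connected component
of the complement of `G - X`. -/
def IsCoComponent (G : SimpleGraph V) (X I : Set V) : Prop :=
  I.Nonempty ∧ I ⊆ Xᶜ ∧ (∀ a ∈ I, ∀ b ∈ I, a ≠ b → ¬ G.Adj a b) ∧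
    (∀ a ∈ I, ∀ b : V, b ∉ X → a ≠ b → ¬ G.Adj a b → b ∈ I)

lemma Identical.symm {G : SimpleGraph V} {X C D : Set V} (h : Identical G X C D) :
    Identical G X D C := by
  obtain ⟨f, hf⟩ := h
  refine ⟨f.symm, fun u => ?_⟩
  simpa using (hf (f.symm u)).symm

lemma Clones.symm {G : SimpleGraph V} {X : Set V} {u v : V} (h : Clones G X u v) :
    Clones G X v u :=
  Eq.symm h

lemma Clones.adj {G : SimpleGraph V} {X : Set V} {u v x : V} (h : Clones G X u v)
    (hx : x ∈ X) (hux : G.Adj u x) : G.Adj v x :=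
  ((Set.ext_iff.1 h x).1 ⟨hux, hx⟩).1

/-- A walk leaving a clique of `G - X` can be mirrored, without increasing its length, to start
in an identical clique. -/
lemma dist_clone_le_length {G : SimpleGraph V} (hG : G.Connected) {X C D : Set V}
    (hC : IsCliqueComponent G X C) (hD : IsCliqueComponent G X D) (hid : Identical G X C D)
    {u w : V} (p : G.Walk u w) (hw : w ∉ C) (hu : u ∈ C) {v : V} (hv : v ∈ D)
    (huv : Clones G X u v) : G.dist v w ≤ p.length := by
  induction p generalizing v with
  | nil => exact absurd hu hw
  | @cons u x w hux p ih =>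
    rw [Walk.length_cons]
    by_cases hx : x ∈ X
    · exact G.dist_le (Walk.cons (huv.adj hx hux) p)
    · have hxC : x ∈ C := hC.2.2.2 u hu x hx hux
      obtain ⟨f, hf⟩ := hid
      have hy : (f ⟨x, hxC⟩ : V) ∈ D := (f ⟨x, hxC⟩).2
      have hyw := ih hw hxC hy (hf ⟨x, hxC⟩).symm
      have hvy : G.dist v (f ⟨x, hxC⟩) ≤ 1 := by
        by_cases h : v = f ⟨x, hxC⟩
        · rw [← h, SimpleGraph.dist_self]
          exact zero_le_one
        · exact (SimpleGraph.dist_eq_one_iff_adj.2 (hD.2.2.1 v hv _ hy h)).le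
      have := hG.dist_triangle (u := v) (v := f ⟨x, hxC⟩) (w := w)
      lia

lemma dist_clone_le {G : SimpleGraph V} (hG : G.Connected) {X C D : Set V}
    (hC : IsCliqueComponent G X C) (hD : IsCliqueComponent G X D) (hid : Identical G X C D)
    {u v w : V} (hw : w ∉ C) (hu : u ∈ C) (hv : v ∈ D) (huv : Clones G X u v) :
    G.dist v w ≤ G.dist u w := by
  obtain ⟨p, hp⟩ := hG.exists_walk_length_eq_dist u w
  exact hp ▸ dist_clone_le_length hG hC hD hid p hw hu hv huv

/-- clones in distinct identical cliques are equidistant from outside vertices. -/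
theorem clones_equidistant [Fintype V] (G : SimpleGraph V) (hG : G.Connected)
    (X : Set V) (hX : IsClusterModulator G X)
    (C1 C2 : Set V) (hC1 : IsCliqueComponent G X C1) (hC2 : IsCliqueComponent G X C2)
    (hne : C1 ≠ C2) (hid : Identical G X C1 C2)
    (u v : V) (hu : u ∈ C1) (hv : v ∈ C2) (huv : Clones G X u v)
    (w : V) (hw : w ∉ C1 ∪ C2) :
    G.dist u w = G.dist v w := by
  exact le_antisymm
    (dist_clone_le hG hC2 hC1 hid.symm (fun h => hw (Or.inr h)) hv hu huv.symm)
    (dist_clone_le hG hC1 hC2 hid (fun h => hw (Or.inl h)) hu hv huv)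
end

section
/- Let G be a connected graph, X a cluster modulator of G, and 𝒞 a set of pairwise distinct, pairwise identical cliques of G − X. Then every resolving set S of G satisfies |S ∩ V(𝒞)| ≥ |𝒞| − 1, where V(𝒞) is the union of the vertex sets of the cliques in 𝒞. -/
open SimpleGraph

variable {V : Type*}

/-- Two cliques of `G - X` sharing a vertex are nested. -/
theorem IsCliqueComponent.subset_of_mem {G : SimpleGraph V} {X C D : Set V}
    (hC : IsCliqueComponent G X C) (hD : IsCliqueComponent G X D) {x : V}
    (hxC : x ∈ C) (hxD : x ∈ D) : C ⊆ D := by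
  intro y hy
  by_cases hxy : x = y
  · exact hxy ▸ hxD
  · exact hD.2.2.2 x hxD y (hC.2.1 hy) (hC.2.2.1 x hxC y hy hxy)

/-- Distinct cliques of `G - X` are disjoint. -/
theorem IsCliqueComponent.eq_of_mem {G : SimpleGraph V} {X C D : Set V}
    (hC : IsCliqueComponent G X C) (hD : IsCliqueComponent G X D) {x : V}
    (hxC : x ∈ C) (hxD : x ∈ D) : C = D :=
  (hC.subset_of_mem hD hxC hxD).antisymm (hD.subset_of_mem hC hxD hxC)

/-- A graph homomorphism from a connected graph does not increase distances. -/
theorem SimpleGraph.Connected.dist_hom_le {W : Type*} {G : SimpleGraph V} {H : SimpleGraph W}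
    (hG : G.Connected) (φ : G →g H) (u v : V) : H.dist (φ u) (φ v) ≤ G.dist u v := by
  obtain ⟨p, hp⟩ := hG.exists_walk_length_eq_dist u v
  rw [← hp, ← Walk.length_map φ p]
  exact dist_le _

/-- Exchanging two distinct identical cliques of `G - X` and fixing all other vertices is a
graph homomorphism. -/
theorem Identical.exists_swap {G : SimpleGraph V} {X C D : Set V}
    (hC : IsCliqueComponent G X C) (hD : IsCliqueComponent G X D) (hne : C ≠ D)
    (h : Identical G X C D) :
    ∃ φ : G →g G, (∀ x ∈ C, φ x ∈ D ∧ φ (φ x) = x) ∧ ∀ x, x ∉ C → x ∉ D → φ x = x := by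
  classical
  obtain ⟨f, hf⟩ := h
  have hdisj : ∀ x ∈ D, x ∉ C := fun x hxD hxC => hne (hC.eq_of_mem hD hxC hxD)
  let σ : V → V := fun x =>
    if hx : x ∈ C then f ⟨x, hx⟩ else if hx : x ∈ D then f.symm ⟨x, hx⟩ else x
  have σC : ∀ x (hx : x ∈ C), σ x = f ⟨x, hx⟩ := fun x hx => by simp [σ, hx]
  have σD : ∀ x (hx : x ∈ D), σ x = f.symm ⟨x, hx⟩ := fun x hx => by simp [σ, hx, hdisj x hx]
  have σo : ∀ x, x ∉ C → x ∉ D → σ x = x := fun x h₁ h₂ => by simp [σ, h₁, h₂]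
  have σCD : ∀ x ∈ C, σ x ∈ D := fun x hx => by rw [σC x hx]; exact (f _).2
  have σDC : ∀ x ∈ D, σ x ∈ C := fun x hx => by rw [σD x hx]; exact (f.symm _).2
  have σσC : ∀ x ∈ C, σ (σ x) = x := fun x hx => by
    rw [σD _ (σCD x hx)]; simp [σC x hx]
  have σσD : ∀ x ∈ D, σ (σ x) = x := fun x hx => by
    rw [σC _ (σDC x hx)]; simp [σD x hx]
  have nbrC : ∀ x ∈ C, ∀ y ∈ X, G.Adj (σ x) y ↔ G.Adj x y := fun x hx y hy => by
    have := Set.ext_iff.1 (hf ⟨x, hx⟩) y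
    simpa [hy, σC x hx] using this
  have nbrD : ∀ x ∈ D, ∀ y ∈ X, G.Adj (σ x) y ↔ G.Adj x y := fun x hx y hy => by
    rw [← nbrC _ (σDC x hx) y hy, σσD x hx]
  have σX : ∀ y ∈ X, σ y = y := fun y hy =>
    σo y (fun h => hC.2.1 h hy) fun h => hD.2.1 h hy
  have key : ∀ a, a ∈ C ∨ a ∈ D → ∀ b, G.Adj a b → G.Adj (σ a) (σ b) := by
    rintro a (ha | ha) b hab <;> by_cases hb : b ∈ X
    · rw [σX b hb]; exact (nbrC a ha b hb).2 hab
    · have hbC := hC.2.2.2 a ha b hb hab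
      refine hD.2.2.1 _ (σCD a ha) _ (σCD b hbC) fun e => hab.ne ?_
      rw [← σσC a ha, e, σσC b hbC]
    · rw [σX b hb]; exact (nbrD a ha b hb).2 hab
    · have hbD := hD.2.2.2 a ha b hb hab
      refine hC.2.2.1 _ (σDC a ha) _ (σDC b hbD) fun e => hab.ne ?_
      rw [← σσD a ha, e, σσD b hbD]
  refine ⟨⟨σ, fun {a b} hab => ?_⟩, fun x hx => ⟨σCD x hx, σσC x hx⟩, σo⟩
  by_cases ha : a ∈ C ∨ a ∈ D
  · exact key a ha b hab
  by_cases hb : b ∈ C ∨ b ∈ D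
  · exact (key b hb a hab.symm).symm
  rw [not_or] at ha hb
  rwa [σo a ha.1 ha.2, σo b hb.1 hb.2]

/-- A resolving set meets at least one of any two distinct identical cliques of `G - X`. -/
theorem IsResolving.inter_nonempty_of_identical {G : SimpleGraph V} (hG : G.Connected)
    {X C D S : Set V} (hS : IsResolving G S) (hC : IsCliqueComponent G X C)
    (hD : IsCliqueComponent G X D) (hne : C ≠ D) (h : Identical G X C D) :
    (S ∩ C).Nonempty ∨ (S ∩ D).Nonempty := by
  by_contra! hempty
  obtain ⟨φ, hφ, hfix⟩ := h.exists_swap hC hD hne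
  obtain ⟨u, hu⟩ := hC.1
  have hu' : u ≠ φ u := fun e => hne (hC.eq_of_mem hD hu (e ▸ (hφ u hu).1))
  obtain ⟨w, hw, hdist⟩ := hS u (φ u) hu'
  have hφw : φ w = w := hfix w
    (fun hwC => Set.eq_empty_iff_forall_notMem.1 hempty.1 w ⟨hw, hwC⟩)
    (fun hwD => Set.eq_empty_iff_forall_notMem.1 hempty.2 w ⟨hw, hwD⟩)
  have h₁ := hG.dist_hom_le φ w u
  have h₂ := hG.dist_hom_le φ w (φ u)
  rw [hφw] at h₁ h₂
  rw [(hφ u hu).2] at h₂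
  exact hdist (h₂.antisymm h₁)

/-- a resolving set contains at least `|𝒞| - 1` vertices of `V(𝒞)`. -/
theorem resolving_inter_class_lower [Fintype V] (G : SimpleGraph V) (hG : G.Connected)
    (X : Set V) (hX : IsClusterModulator G X)
    (𝒞 : Set (Set V)) (h1 : ∀ C ∈ 𝒞, IsCliqueComponent G X C)
    (h2 : ∀ C1 ∈ 𝒞, ∀ C2 ∈ 𝒞, Identical G X C1 C2)
    (S : Set V) (hS : IsResolving G S) :
    𝒞.ncard - 1 ≤ (S ∩ ⋃₀ 𝒞).ncard := by
  set M : Set (Set V) := {C ∈ 𝒞 | (S ∩ C).Nonempty}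
  have hM : M ⊆ 𝒞 := Set.sep_subset _ _
  have hrest : (𝒞 \ M).ncard ≤ 1 := by
    refine (Set.ncard_le_one (Set.toFinite _)).2 fun C hC D hD => ?_
    by_contra hne
    rcases hS.inter_nonempty_of_identical hG (h1 C hC.1) (h1 D hD.1) hne
      (h2 C hC.1 D hD.1) with h | h
    · exact hC.2 ⟨hC.1, h⟩
    · exact hD.2 ⟨hD.1, h⟩
  have : Nonempty V := hG.nonempty
  have hpick : ∀ C ∈ M, ∃ x, x ∈ S ∩ C := fun C hC => hC.2
  choose! g hg using hpick
  have hcard : M.ncard ≤ (S ∩ ⋃₀ 𝒞).ncard :=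
    Set.ncard_le_ncard_of_injOn g (fun C hC => ⟨(hg C hC).1, C, hC.1, (hg C hC).2⟩)
      fun C hC D hD e =>
        (h1 C hC.1).eq_of_mem (h1 D hD.1) (hg C hC).2 (e ▸ (hg D hD).2)
  have := Set.ncard_sdiff_add_ncard_of_subset hM
  omega
end

section
/- Let G be a connected graph in which no three distinct vertices are pairwise true twins, X a cluster modulator of G, and 𝒞 an equivalence class of identical cliques of G − X with |𝒞| ≥ |X| + 2 and t(𝒞) = 0. Then for every minimum resolving set S of G, at most one clique C ∈ 𝒞 satisfies S ∩ V(C) = ∅, and at most |X| + 1 cliques C ∈ 𝒞 satisfy |S ∩ V(C)| ≥ 2. -/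
open SimpleGraph

variable {V : Type*}

namespace IsCliqueComponent

variable {G : SimpleGraph V} {X C D : Set V}

theorem eq_of_mem_s9 (hC : IsCliqueComponent G X C) (hD : IsCliqueComponent G X D)
    {a : V} (haC : a ∈ C) (haD : a ∈ D) : C = D := by
  have key : ∀ {A B : Set V}, IsCliqueComponent G X A → IsCliqueComponent G X B →
      a ∈ A → a ∈ B → A ⊆ B := by
    intro A B hA hB haA haB c hc
    by_cases h : a = c
    · exact h ▸ haB
    · exact hB.2.2.2 a haB c (hA.2.1 hc) (hA.2.2.1 a haA c hc h)
  exact Set.Subset.antisymm (key hC hD haC haD) (key hD hC haD haC)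

/-- Two clique-mates with the same neighborhood in the modulator are true twins. -/
theorem trueTwins (hC : IsCliqueComponent G X C) {u v : V} (hu : u ∈ C) (hv : v ∈ C)
    (huv : u ≠ v) (h : ∀ x ∈ X, G.Adj u x ↔ G.Adj v x) : TrueTwins G u v := by
  refine ⟨huv, ?_⟩
  have key : ∀ {a b : V}, a ∈ C → b ∈ C → a ≠ b → (∀ x ∈ X, G.Adj a x ↔ G.Adj b x) →
      insert a (G.neighborSet a) ⊆ insert b (G.neighborSet b) := by
    intro a b ha hb hab hx c hc
    simp only [Set.mem_insert_iff, mem_neighborSet] at hc ⊢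
    by_cases hcb : c = b
    · exact Or.inl hcb
    right
    rcases hc with rfl | hc
    · exact hC.2.2.1 b hb c ha (Ne.symm hab)
    · by_cases hcX : c ∈ X
      · exact (hx c hcX).1 hc
      · exact hC.2.2.1 b hb c (hC.2.2.2 a ha c hcX hc) (Ne.symm hcb)
  exact Set.Subset.antisymm (key hu hv huv h)
    (key hv hu huv.symm fun x hx => (h x hx).symm)

/-- Matched vertices of identical cliques: the image is at least as close to every vertex
outside the first clique. -/
theorem dist_equiv_le (hG : G.Connected) (hC : IsCliqueComponent G X C)
    (hD : IsCliqueComponent G X D) (f : C ≃ D)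
    (hf : ∀ u : C, G.neighborSet (f u) ∩ X = G.neighborSet u ∩ X)
    {w : V} (hw : w ∉ C) (u : C) : G.dist w (f u) ≤ G.dist w u := by
  have key : ∀ {a : V} (p : G.Walk a w) (ha : a ∈ C), G.dist (f ⟨a, ha⟩) w ≤ p.length := by
    intro a p
    induction p with
    | nil => exact fun ha => absurd ha hw
    | @cons a b w hab q ih =>
      intro ha
      have step : ∀ c : V, G.Adj (f ⟨a, ha⟩) c → G.dist c w ≤ q.length →
          G.dist (f ⟨a, ha⟩) w ≤ (Walk.cons hab q).length := by
        intro c hc hcw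
        have h1 := hG.dist_triangle (u := (f ⟨a, ha⟩ : V)) (v := c) (w := w)
        have h2 := dist_eq_one_iff_adj.2 hc
        rw [Walk.length_cons]
        omega
      by_cases hb : b ∈ C
      · refine step _ (hD.2.2.1 _ (f ⟨a, ha⟩).2 _ (f ⟨b, hb⟩).2 ?_) (ih hw hb)
        intro h
        have := f.injective (Subtype.ext h)
        exact hab.ne (congrArg Subtype.val this)
      · have hbX : b ∈ X := by
          by_contra hbX
          exact hb (hC.2.2.2 a ha b hbX hab)
        have : b ∈ G.neighborSet (f ⟨a, ha⟩) ∩ X := by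
          rw [hf]
          exact ⟨hab, hbX⟩
        exact step b this.1 (dist_le q)
  obtain ⟨p, hp⟩ := hG.exists_walk_length_eq_dist (u : V) w
  rw [SimpleGraph.dist_comm, SimpleGraph.dist_comm (u := w), ← hp]
  exact key p u.2

end IsCliqueComponent

section Modulator

variable {G : SimpleGraph V} {X S T : Set V} {u v w : V}

/-- Outside its clique, a vertex is reached by shortest paths through the modulator. -/
theorem IsClusterModulator.exists_dist_add_dist_le (hG : G.Connected)
    (hX : IsClusterModulator G X) (hu : u ∉ X) (hw : w ∈ X ∨ (w ≠ u ∧ ¬ G.Adj w u)) :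
    ∃ x ∈ X, G.dist w x + G.dist x u ≤ G.dist w u := by
  classical
  obtain ⟨p, hp⟩ := hG.exists_walk_length_eq_dist w u
  have hx : ∃ x ∈ p.support, x ∈ X := by
    by_contra! h
    have hwX : w ∉ X := h w p.start_mem_support
    obtain ⟨hne, hadj⟩ := hw.resolve_left hwX
    rcases hX ⟨w, hwX⟩ ⟨u, hu⟩ ⟨p.induce Xᶜ h⟩ with he | he
    · exact hne (congrArg Subtype.val he)
    · exact hadj he
  obtain ⟨x, hxp, hxX⟩ := hx
  refine ⟨x, hxX, ?_⟩
  have h1 := congrArg Walk.length (p.take_spec hxp)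
  rw [Walk.length_append] at h1
  have h2 := dist_le (p.takeUntil x hxp)
  have h3 := dist_le (p.dropUntil x hxp)
  omega

/-- Vertices at equal distances from the modulator can only be resolved from their cliques. -/
theorem IsClusterModulator.dist_le_dist (hG : G.Connected)
    (hX : IsClusterModulator G X) (h : ∀ x ∈ X, G.dist x u = G.dist x v) (hu : u ∉ X)
    (hw : w ∈ X ∨ (w ≠ u ∧ ¬ G.Adj w u)) : G.dist w v ≤ G.dist w u := by
  obtain ⟨x, hx, hle⟩ := hX.exists_dist_add_dist_le hG hu hw
  have := hG.dist_triangle (u := w) (v := x) (w := v)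
  have := h x hx
  omega

/-- A resolving set stays resolving if it is enlarged by the modulator and then some vertices are
removed from twin-free cliques, as long as these cliques keep a selected vertex. -/
theorem IsResolving.of_modulator_subset (hG : G.Connected) (hX : IsClusterModulator G X)
    (hS : IsResolving G S) (hXT : X ⊆ T)
    (hST : ∀ s ∈ S, s ∉ T → ∃ C, IsCliqueComponent G X C ∧ s ∈ C ∧ (T ∩ C).Nonempty ∧
      ∀ a ∈ C, ∀ b ∈ C, ¬ TrueTwins G a b) :
    IsResolving G T := by
  intro u v huv
  by_contra! h
  have not_mem : ∀ {a b : V}, a ≠ b → (∀ w ∈ T, G.dist w a = G.dist w b) → a ∉ T := by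
    intro a b hab hd ha
    have := hd a ha
    rw [dist_self] at this
    exact hab (hG.dist_eq_zero_iff.1 this.symm)
  have far : ∀ {a b : V}, a ≠ b → (∀ w ∈ T, G.dist w a = G.dist w b) →
      ∀ w ∈ S, w ∉ T → w ∈ X ∨ (w ≠ a ∧ ¬ G.Adj w a) := by
    intro a b hab hd w hwS hwT
    have haT := not_mem hab hd
    have hbT := not_mem hab.symm fun w hw => (hd w hw).symm
    have haX : a ∉ X := fun h => haT (hXT h)
    have hbX : b ∉ X := fun h => hbT (hXT h)
    have adj_iff : ∀ t ∈ T, G.Adj t a ↔ G.Adj t b := by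
      intro t ht
      rw [← dist_eq_one_iff_adj, ← dist_eq_one_iff_adj, hd t ht]
    by_contra hcon
    rw [not_or, not_and_or, not_not, not_not] at hcon
    obtain ⟨-, hwa⟩ := hcon
    obtain ⟨C, hC, hwC, ⟨s, hsT, hsC⟩, hCt⟩ := hST w hwS hwT
    have haC : a ∈ C := by
      rcases hwa with rfl | hwa
      · exact hwC
      · exact hC.2.2.2 w hwC a haX hwa
    have hsa : G.Adj s a := hC.2.2.1 s hsC a haC fun e => haT (e ▸ hsT)
    have hbC := hC.2.2.2 s hsC b hbX ((adj_iff s hsT).1 hsa)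
    refine hCt a haC b hbC (hC.trueTwins haC hbC hab fun x hx => ?_)
    rw [G.adj_comm a, G.adj_comm b]
    exact adj_iff x (hXT hx)
  have h' : ∀ w ∈ T, G.dist w v = G.dist w u := fun w hw => (h w hw).symm
  obtain ⟨w, hw, hne⟩ := hS u v huv
  have hwT : w ∉ T := fun hwT => hne (h w hwT)
  refine hne (le_antisymm ?_ ?_)
  · exact hX.dist_le_dist hG (fun x hx => h' x (hXT hx))
      (fun hv => not_mem huv.symm h' (hXT hv)) (far huv.symm h' w hw hwT)
  · exact hX.dist_le_dist hG (fun x hx => h x (hXT hx))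
      (fun hu => not_mem huv h (hXT hu)) (far huv h w hw hwT)

end Modulator

/-- partition bounds when `t(𝒞) = 0`. -/
theorem class_partition_bounds_t_zero [Fintype V] (G : SimpleGraph V) (hG : G.Connected)
    (hT : NoThreeTrueTwins G) (X : Set V) (hX : IsClusterModulator G X)
    (𝒞 : Set (Set V)) (h𝒞 : IsIdenticalClass G X 𝒞)
    (ht : ∀ C ∈ 𝒞, twinPairCount G C = 0)
    (hcard : X.ncard + 2 ≤ 𝒞.ncard)
    (S : Set V) (hS : IsResolving G S)
    (hmin : ∀ T : Set V, IsResolving G T → S.ncard ≤ T.ncard) :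
    {C ∈ 𝒞 | S ∩ C = ∅}.ncard ≤ 1 ∧
      {C ∈ 𝒞 | 2 ≤ (S ∩ C).ncard}.ncard ≤ X.ncard + 1 := by
  obtain ⟨hcomp, hident, -⟩ := h𝒞
  constructor
  · refine (Set.ncard_le_one_iff (Set.toFinite _)).2 ?_
    rintro C D ⟨hC, hSC⟩ ⟨hD, hSD⟩
    by_contra hCD
    obtain ⟨f, hf⟩ := hident C hC D hD
    obtain ⟨u, hu⟩ := (hcomp C hC).1
    have hne : u ≠ f ⟨u, hu⟩ := fun h =>
      hCD ((hcomp C hC).eq_of_mem_s9 (hcomp D hD) hu (h ▸ (f ⟨u, hu⟩).2))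
    obtain ⟨w, hwS, hw⟩ := hS _ _ hne
    have hwC : w ∉ C := fun h => Set.eq_empty_iff_forall_notMem.1 hSC w ⟨hwS, h⟩
    have hwD : w ∉ D := fun h => Set.eq_empty_iff_forall_notMem.1 hSD w ⟨hwS, h⟩
    refine hw (le_antisymm ?_ ?_)
    · have hle := (hcomp D hD).dist_equiv_le hG (hcomp C hC) f.symm
        (fun v => by rw [← hf, f.apply_symm_apply]) hwD (f ⟨u, hu⟩)
      rwa [f.symm_apply_apply] at hle
    · exact (hcomp C hC).dist_equiv_le hG (hcomp D hD) f hf hwC ⟨u, hu⟩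
  · by_contra! hlt
    set B : Set (Set V) := {C ∈ 𝒞 | 2 ≤ (S ∩ C).ncard}
    have hpair : ∀ C : Set V, ∃ a b : V, C ∈ B → a ∈ S ∩ C ∧ b ∈ S ∩ C ∧ a ≠ b := by
      intro C
      by_cases hC : C ∈ B
      · obtain ⟨a, ha, b, hb, hab⟩ := (Set.one_lt_ncard (Set.toFinite _)).1 hC.2
        exact ⟨a, b, fun _ => ⟨ha, hb, hab⟩⟩
      · obtain ⟨v⟩ := hG.nonempty
        exact ⟨v, v, fun h => absurd h hC⟩
    choose a b hab using hpair
    have heq : ∀ C ∈ B, ∀ D ∈ B, ∀ v, v ∈ C → v ∈ D → C = D := fun C hC D hD v hvC hvD =>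
      (hcomp C hC.1).eq_of_mem_s9 (hcomp D hD.1) hvC hvD
    have hinj : Set.InjOn b B := fun C hC D hD h =>
      heq C hC D hD _ (hab C hC).2.1.2 (h ▸ (hab D hD).2.1.2)
    have hsub : b '' B ⊆ S := by
      rintro _ ⟨C, hC, rfl⟩
      exact (hab C hC).2.1.1
    have hres : IsResolving G (X ∪ (S \ b '' B)) := by
      refine hS.of_modulator_subset hG hX Set.subset_union_left fun s hs hsT => ?_
      have hsB : s ∈ b '' B := by
        by_contra hsB
        exact hsT (Or.inr ⟨hs, hsB⟩)
      obtain ⟨C, hC, rfl⟩ := hsB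
      refine ⟨C, hcomp C hC.1, (hab C hC).2.1.2,
        ⟨a C, Or.inr ⟨(hab C hC).1.1, ?_⟩, (hab C hC).1.2⟩, ?_⟩
      · rintro ⟨D, hD, hDa⟩
        have hCD := heq C hC D hD (a C) (hab C hC).1.2 (hDa ▸ (hab D hD).2.1.2)
        exact (hab C hC).2.2 (by rw [← hDa, hCD])
      · intro u hu v hv huv
        have hempty := (Set.ncard_eq_zero (Set.toFinite _)).1 (ht C hC.1)
        exact Set.eq_empty_iff_forall_notMem.1 hempty {u, v} ⟨u, hu, v, hv, huv, rfl⟩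
    have h1 := hmin _ hres
    have h2 := Set.ncard_union_le X (S \ b '' B)
    have h3 := Set.ncard_sdiff_add_ncard_of_subset hsub
    rw [hinj.ncard_image] at h3
    omega
end
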